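/- As m → ∞, the spectral measures of the petal graphs on 2m+1 vertices converge weakly to the measure (1/2)δ_{1/2} + (1/2)δ_{3/2} on [0,2]. -/

import Mathlib

open MeasureTheory Filter
open scoped ENNReal

/- The petal (friendship) graph on `2m+1` vertices: `m` triangles all joined at one
common vertex (`none` is the common center). -/
def petalGraph (m : ℕ) : SimpleGraph (Option (Fin m × Fin 2)) :=
  SimpleGraph.fromRel fun x y =>
    (x = none ∧ y ≠ none) ∨ ∃ i : Fin m, x = some (i, 0) ∧ y = some (i, 1)

/- The normalized Laplacian `Δ_G = I - D⁻¹ A` of a finite simple graph. -/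
open scoped Classical in
noncomputable def normLap {V : Type*} [Fintype V] (G : SimpleGraph V) : Matrix V V ℝ :=
  Matrix.of fun i j =>
    (if i = j then (1 : ℝ) else 0) -
      (if G.Adj i j then 1 / ((Finset.univ.filter fun k => G.Adj i k).card : ℝ) else 0)

/- The spectral measure `μ(G) = (1/n) ∑_i δ_{λ_i}` of a graph `G` on `n` vertices,
where the `λ_i` are the eigenvalues of the normalized Laplacian counted with
multiplicity (roots of its characteristic polynomial). -/
noncomputable def specMeasure {V : Type*} [Fintype V] [DecidableEq V]
    (G : SimpleGraph V) : Measure ℝ :=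
  ((Fintype.card V : ℝ≥0∞))⁻¹ •
    (((normLap G).charpoly.roots).map MeasureTheory.Measure.dirac).sum

lemma petalGraph_adj_none_left {m : ℕ} (y : Option (Fin m × Fin 2)) :
    (petalGraph m).Adj none y ↔ y ≠ none := by
  rcases y with _ | y <;> simp [petalGraph]

lemma petalGraph_adj_some_none {m : ℕ} (p : Fin m × Fin 2) :
    (petalGraph m).Adj (some p) none := by
  simp [petalGraph]

lemma petalGraph_adj_some_some {m : ℕ} (p q : Fin m × Fin 2) :
    (petalGraph m).Adj (some p) (some q) ↔ p.1 = q.1 ∧ p.2 ≠ q.2 := by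
  obtain ⟨i, a⟩ := p
  obtain ⟨j, b⟩ := q
  fin_cases a <;> fin_cases b <;> simp [petalGraph, eq_comm]

open scoped Classical in
lemma card_petalGraph_adj_none (m : ℕ) :
    (Finset.univ.filter fun k => (petalGraph m).Adj none k).card = 2 * m := by
  have h : (Finset.univ.filter fun k => (petalGraph m).Adj none k) =
      Finset.univ.map Function.Embedding.some := by
    ext y
    rcases y with _ | y <;> simp [petalGraph_adj_none_left]
  rw [h, Finset.card_map, Finset.card_univ]
  simp [mul_comm]

open scoped Classical in
lemma card_petalGraph_adj_some {m : ℕ} (p : Fin m × Fin 2) :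
    (Finset.univ.filter fun k => (petalGraph m).Adj (some p) k).card = 2 := by
  have h : (Finset.univ.filter fun k => (petalGraph m).Adj (some p) k) =
      {none, some (p.1, 1 - p.2)} := by
    ext y
    obtain ⟨i, a⟩ := p
    rcases y with _ | ⟨j, b⟩
    · simp [petalGraph_adj_some_none]
    · fin_cases a <;> fin_cases b <;> simp [petalGraph_adj_some_some, eq_comm]
  rw [h, Finset.card_pair (by simp)]

/-- With the center listed last, `x • 1 - Δ` for the petal graph is a bordered block-diagonal
matrix. -/
lemma reindex_scalar_sub_normLap_petalGraph (m : ℕ) (x : ℝ) :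
    Matrix.reindex (Equiv.optionEquivSumPUnit _) (Equiv.optionEquivSumPUnit _)
        (Matrix.scalar _ x - normLap (petalGraph m)) =
      Matrix.fromBlocks
        (Matrix.kronecker (1 : Matrix (Fin m) (Fin m) ℝ) !![x - 1, 1 / 2; 1 / 2, x - 1])
        (Matrix.of fun _ (_ : PUnit.{1}) => 1 / 2)
        (Matrix.of fun (_ : PUnit.{1}) _ => 1 / (2 * (m : ℝ)))
        (Matrix.of fun _ _ => x - 1) := by
  ext u v
  rcases u with ⟨i, a⟩ | u <;> rcases v with ⟨j, b⟩ | v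
  · by_cases hij : i = j
    · subst hij
      fin_cases a <;> fin_cases b <;>
        simp [normLap, petalGraph_adj_some_some, card_petalGraph_adj_some]
    · simp [normLap, petalGraph_adj_some_some, hij]
  · simp [normLap, petalGraph_adj_some_none, card_petalGraph_adj_some]
  · simp only [normLap, Matrix.reindex_apply, Matrix.submatrix_apply, Matrix.sub_apply,
      Matrix.of_apply, Equiv.optionEquivSumPUnit_symm_inl, Equiv.optionEquivSumPUnit_symm_inr,
      card_petalGraph_adj_none, Matrix.fromBlocks_apply₂₁]
    simp [petalGraph_adj_none_left]
  · simp [normLap]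

lemma det_scalar_sub_normLap_petalGraph (k : ℕ) {x : ℝ} (hx : x ≠ 1 / 2) :
    (Matrix.scalar _ x - normLap (petalGraph (k + 1))).det =
      x * (x - 1 / 2) ^ k * (x - 3 / 2) ^ (k + 2) := by
  have hx' : x - 1 / 2 ≠ 0 := sub_ne_zero.mpr hx
  have hx2 : 2 * x - 1 ≠ 0 := fun h => hx (by linarith)
  have hk : ((k : ℝ) + 1) ≠ 0 := by positivity
  set c : ℝ := -(1 / 2) / (x - 1 / 2) with hc
  rw [← Matrix.det_reindex_self (Equiv.optionEquivSumPUnit _),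
    reindex_scalar_sub_normLap_petalGraph]
  set D : Matrix (Fin (k + 1) × Fin 2) (Fin (k + 1) × Fin 2) ℝ :=
    Matrix.kronecker 1 !![x - 1, 1 / 2; 1 / 2, x - 1] with hD
  set B : Matrix PUnit.{1} (Fin (k + 1) × Fin 2) ℝ :=
    Matrix.of fun _ _ => 1 / (2 * ((k + 1 : ℕ) : ℝ)) with hB
  set w : Matrix (Fin (k + 1) × Fin 2) PUnit.{1} ℝ := Matrix.of fun _ _ => c with hw
  set U : Matrix ((Fin (k + 1) × Fin 2) ⊕ PUnit.{1}) ((Fin (k + 1) × Fin 2) ⊕ PUnit.{1}) ℝ :=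
    Matrix.fromBlocks 1 w 0 1 with hU
  have hmul (M : Matrix ((Fin (k + 1) × Fin 2) ⊕ PUnit.{1})
      ((Fin (k + 1) × Fin 2) ⊕ PUnit.{1}) ℝ) : M.det = (M * U).det := by simp [hU]
  have hdetD : D.det = ((x - 1 / 2) * (x - 3 / 2)) ^ (k + 1) := by
    rw [hD, Matrix.kronecker, Matrix.det_kronecker, Matrix.det_fin_two_of]
    simp only [Matrix.det_one, one_pow, one_mul, Fintype.card_fin]
    ring
  have hcol : D * w +
      (Matrix.of fun _ _ => 1 / 2 : Matrix (Fin (k + 1) × Fin 2) PUnit.{1} ℝ) = 0 := by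
    ext ⟨i, a⟩ u
    have : c * (x - 1 / 2) = -(1 / 2) := div_mul_cancel₀ _ hx'
    fin_cases a <;>
      simp [hD, hw, Matrix.mul_apply, Fintype.sum_prod_type, Matrix.one_apply] <;> linarith
  have hcorner : (B * w + Matrix.of fun _ _ => x - 1) =
      Matrix.of fun (_ _ : PUnit.{1}) => x * (x - 3 / 2) / (x - 1 / 2) := by
    ext u v
    simp only [hB, hw, Matrix.add_apply, Matrix.mul_apply, Matrix.of_apply, Finset.sum_const,
      Finset.card_univ, Fintype.card_prod, Fintype.card_fin, nsmul_eq_mul, hc]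
    push_cast
    field_simp
    ring
  rw [hmul, hU, Matrix.fromBlocks_multiply]
  simp only [Matrix.mul_one, Matrix.mul_zero, add_zero, hcol, hcorner,
    Matrix.det_fromBlocks_zero₁₂, hdetD, Matrix.det_unique, Matrix.of_apply]
  rw [← mul_div_assoc, div_eq_iff hx', mul_pow]
  ring

open Polynomial in
lemma charpoly_normLap_petalGraph (k : ℕ) :
    (normLap (petalGraph (k + 1))).charpoly =
      (X - C 0) * (X - C (1 / 2)) ^ k * (X - C (3 / 2)) ^ (k + 2) := by
  refine Polynomial.eq_of_infinite_eval_eq _ _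
    ((Set.finite_singleton (1 / 2 : ℝ)).infinite_compl.mono fun x hx => ?_)
  simp only [Set.mem_ofPred_eq, Matrix.eval_charpoly, det_scalar_sub_normLap_petalGraph k hx]
  simp

lemma roots_charpoly_normLap_petalGraph (k : ℕ) :
    (normLap (petalGraph (k + 1))).charpoly.roots =
      {0} + Multiset.replicate k (1 / 2) + Multiset.replicate (k + 2) (3 / 2) := by
  have h := fun a : ℝ => Polynomial.X_sub_C_ne_zero a
  rw [charpoly_normLap_petalGraph, Polynomial.roots_mul, Polynomial.roots_mul,
    Polynomial.roots_pow, Polynomial.roots_pow, Polynomial.roots_X_sub_C, Polynomial.roots_X_sub_C,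
    Polynomial.roots_X_sub_C, Multiset.nsmul_singleton, Multiset.nsmul_singleton]
  · exact mul_ne_zero (h _) (pow_ne_zero _ (h _))
  · exact mul_ne_zero (mul_ne_zero (h _) (pow_ne_zero _ (h _))) (pow_ne_zero _ (h _))

lemma integrable_and_integral_sum_map_dirac (f : ℝ → ℝ) (s : Multiset ℝ) :
    Integrable f (s.map Measure.dirac).sum ∧
      ∫ x, f x ∂(s.map Measure.dirac).sum = (s.map f).sum := by
  induction s using Multiset.induction_on with
  | empty => simp
  | cons a s ih =>
    have ha : Integrable f (Measure.dirac a) := integrable_dirac (by simp)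
    simp only [Multiset.map_cons, Multiset.sum_cons]
    exact ⟨ha.add_measure ih.1, by rw [integral_add_measure ha ih.1, ih.2, integral_dirac]⟩

lemma integral_specMeasure_petalGraph (f : ℝ → ℝ) (k : ℕ) :
    ∫ x, f x ∂specMeasure (petalGraph (k + 1)) =
      (2 * (k : ℝ) + 3)⁻¹ * (f 0 + k * f (1 / 2) + (k + 2) * f (3 / 2)) := by
  rw [specMeasure, integral_smul_measure, (integrable_and_integral_sum_map_dirac f _).2,
    roots_charpoly_normLap_petalGraph]
  have hcard : (Fintype.card (Option (Fin (k + 1) × Fin 2)) : ℝ) = 2 * k + 3 := by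
    simp only [Fintype.card_option, Fintype.card_prod, Fintype.card_fin]
    push_cast
    ring
  simp only [ENNReal.toReal_inv, ENNReal.toReal_natCast, hcard, Multiset.map_add,
    Multiset.map_singleton, Multiset.map_replicate, Multiset.sum_add, Multiset.sum_singleton,
    Multiset.sum_replicate, nsmul_eq_mul, smul_eq_mul]
  push_cast
  rfl

/-- As `m → ∞`, the spectral measures of the petal graphs on `2m+1` vertices converge
weakly to `(1/2)δ_{1/2} + (1/2)δ_{3/2}`: for every continuous `f : [0,2] → ℝ`,
`∫ f dμ(G_m) → (1/2) f(1/2) + (1/2) f(3/2)`. -/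
theorem specMeasure_petalGraph_tendsto :
    ∀ f : ℝ → ℝ, ContinuousOn f (Set.Icc 0 2) →
      Tendsto (fun m : ℕ => ∫ x, f x ∂ specMeasure (petalGraph m))
        atTop (nhds ((1 / 2) * f (1 / 2) + (1 / 2) * f (3 / 2))) := by
  intro f _
  rw [← tendsto_add_atTop_iff_nat 1]
  have hinv : Tendsto (fun k : ℕ => (2 * (k : ℝ) + 3)⁻¹) atTop (nhds 0) :=
    tendsto_inv_atTop_zero.comp <| tendsto_atTop_add_const_right _ _ <|
      tendsto_natCast_atTop_atTop.const_mul_atTop two_pos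
  have hlim := (hinv.mul_const (f 0 - 3 / 2 * f (1 / 2) + 1 / 2 * f (3 / 2))).add_const
    ((1 / 2) * f (1 / 2) + (1 / 2) * f (3 / 2))
  rw [zero_mul, zero_add] at hlim
  refine hlim.congr fun k => ?_
  rw [integral_specMeasure_petalGraph]
  have : 2 * (k : ℝ) + 3 ≠ 0 := by positivity
  field_simp
  ring
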